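/- Assume r > c and fix distinct indices i_1, i_2 ∈ {0,…,r} and j_1 ∈ {1,…,n_{i_1}}, j_2 ∈ {1,…,n_{i_2}}. (a) There exists a point z ∈ X̄ whose set of nonzero coordinates is exactly {z_{i_1j_1}, z_{i_2j_2}} if and only if either n_{i_1} ≥ 2 and n_{i_2} ≥ 2, or n_{i_1} = n_{i_2} = 1 and r = c+1. (b) If moreover the exponent data is irredundant and n_{i_1} ≥ 2 and n_{i_2} ≥ 2, then every z ∈ X̄ whose set of nonzero coordinates is exactly {z_{i_1j_1}, z_{i_2j_2}} satisfies rank J(z) = r−c if and only if one of the following holds: (i) r = c+1 and for some t ∈ {1,2} one has n_{i_t} = 2 and l_{i_t j'} = 1 for the unique index j' ≠ j_t; (ii) r = c+2, n_{i_1} = n_{i_2} = 2, and l_{i_1 j'} = 1 for the unique j' ≠ j_1 and l_{i_2 j''} = 1 for the unique j'' ≠ j_2. -/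

import Mathlib

open MvPolynomial

noncomputable section

/-- Index type for the variables `T i j` (`Sum.inl ⟨i, j⟩`) and `S k` (`Sum.inr k`). -/
abbrev VarIdx (r m : ℕ) (nn : Fin (r + 1) → ℕ) : Type :=
  (Σ i : Fin (r + 1), Fin (nn i)) ⊕ Fin m

variable (𝕂 : Type) [Field 𝕂]

/-- The monomial `T_i^{l_i} = ∏_j T_{ij}^{l_{ij}}`. -/
def Tmon (r m : ℕ) (nn : Fin (r + 1) → ℕ)
    (l : ∀ i : Fin (r + 1), Fin (nn i) → ℕ) (i : Fin (r + 1)) :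
    MvPolynomial (VarIdx r m nn) 𝕂 :=
  ∏ j : Fin (nn i), (X (Sum.inl ⟨i, j⟩) : MvPolynomial (VarIdx r m nn) 𝕂) ^ l i j

/-- The map sending a column index of the `(c+2)×(c+2)` matrix defining `g_t`
to the corresponding column index of `A`, namely `0, …, c, c + (t+1)`. -/
def colOf (r c : ℕ) (hcr : c ≤ r) (t : Fin (r - c)) (p : Fin (c + 2)) : Fin (r + 1) :=
  if h : (p : ℕ) ≤ c then ⟨p, by omega⟩
  else ⟨c + 1 + t, by have := t.isLt; omega⟩

/-- The polynomial `g_t`: the determinant of the `(c+2)×(c+2)` matrix whose first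
`c+1` rows are formed by the columns `a_0, …, a_c, a_{c+t}` of `A` (as constant
polynomials) and whose last row is `(T_0^{l_0}, …, T_c^{l_c}, T_{c+t}^{l_{c+t}})`. -/
def gPoly (r c m : ℕ) (hcr : c ≤ r) (nn : Fin (r + 1) → ℕ)
    (l : ∀ i : Fin (r + 1), Fin (nn i) → ℕ)
    (A : Matrix (Fin (c + 1)) (Fin (r + 1)) 𝕂) (t : Fin (r - c)) :
    MvPolynomial (VarIdx r m nn) 𝕂 :=
  Matrix.det (Matrix.of fun q p : Fin (c + 2) =>
    if h : (q : ℕ) < c + 1 then C (A ⟨q, h⟩ (colOf r c hcr t p))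
    else Tmon 𝕂 r m nn l (colOf r c hcr t p))

/-- The ring `R = 𝕂[T_{ij}, S_k] / ⟨g_1, …, g_{r-c}⟩`. -/
abbrev RingAP (r c m : ℕ) (hcr : c ≤ r) (nn : Fin (r + 1) → ℕ)
    (l : ∀ i : Fin (r + 1), Fin (nn i) → ℕ)
    (A : Matrix (Fin (c + 1)) (Fin (r + 1)) 𝕂) : Type :=
  MvPolynomial (VarIdx r m nn) 𝕂 ⧸ Ideal.span (Set.range (gPoly 𝕂 r c m hcr nn l A))

end

noncomputable section
variable (𝕂 : Type) [Field 𝕂]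

/-- A point `z ∈ 𝕂^{n+m}` is of big type if for every `i = 0,…,r` some
coordinate `z_{ij}` vanishes. -/
def BigType (r m : ℕ) (nn : Fin (r + 1) → ℕ) (z : VarIdx r m nn → 𝕂) : Prop :=
  ∀ i : Fin (r + 1), ∃ j : Fin (nn i), z (Sum.inl ⟨i, j⟩) = 0

/-- A point `z ∈ 𝕂^{n+m}` is of leaf type if there is a set `I ⊆ {0,…,r}` with at most
`c` elements such that `z_{ij} = 0` implies `i ∈ I`. -/
def LeafType (r c m : ℕ) (nn : Fin (r + 1) → ℕ) (z : VarIdx r m nn → 𝕂) : Prop :=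
  ∃ I : Finset (Fin (r + 1)), I.card ≤ c ∧
    ∀ (i : Fin (r + 1)) (j : Fin (nn i)), z (Sum.inl ⟨i, j⟩) = 0 → i ∈ I

/-- The Jacobian matrix of `g_1, …, g_{r-c}` evaluated at the point `z`. -/
def Jac (r c m : ℕ) (hcr : c ≤ r) (nn : Fin (r + 1) → ℕ)
    (l : ∀ i : Fin (r + 1), Fin (nn i) → ℕ)
    (A : Matrix (Fin (c + 1)) (Fin (r + 1)) 𝕂) (z : VarIdx r m nn → 𝕂) :
    Matrix (Fin (r - c)) (VarIdx r m nn) 𝕂 :=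
  Matrix.of fun t v =>
    MvPolynomial.eval z (MvPolynomial.pderiv v (gPoly 𝕂 r c m hcr nn l A t))

end

/-- Laplace expansion along the last row, for a matrix given by its first rows and its last row. -/
lemma det_of_last_row {R : Type*} [CommRing R] {c : ℕ}
    (B : Matrix (Fin (c + 1)) (Fin (c + 2)) R) (y : Fin (c + 2) → R) :
    Matrix.det (Matrix.of fun q p : Fin (c + 2) =>
        if h : (q : ℕ) < c + 1 then B ⟨q, h⟩ p else y p) =
      ∑ p : Fin (c + 2), (-1) ^ (c + 1 + (p : ℕ)) * (B.submatrix id p.succAbove).det * y p := by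
  rw [Matrix.det_succ_row _ (Fin.last (c + 1))]
  refine Finset.sum_congr rfl fun p _ => ?_
  have hsub : (Matrix.of fun q p : Fin (c + 2) =>
        if h : (q : ℕ) < c + 1 then B ⟨q, h⟩ p else y p).submatrix
          (Fin.last (c + 1)).succAbove p.succAbove = B.submatrix id p.succAbove := by
    ext a b
    have ha : ¬ c < (a : ℕ) := by omega
    simp [Fin.succAbove_last, ha]
  rw [hsub]
  simp
  ring

section Matrices

variable {K ι V : Type*} [Field K] [Fintype ι] [Fintype V] {k : ℕ}

lemma rank_eq_iff_vecMul_eq_zero (M : Matrix (Fin k) V K) :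
    M.rank = k ↔ ∀ v, Matrix.vecMul v M = 0 → v = 0 := by
  have h := injective_iff_map_eq_zero M.vecMulLinear
  rw [Matrix.coe_vecMulLinear, Matrix.vecMul_injective_iff,
    linearIndependent_iff_card_eq_finrank_span, Fintype.card_fin, Set.finrank,
    ← Matrix.rank_eq_finrank_span_row, eq_comm] at h
  exact h

/-- A matrix with `k` rows is totally of full rank if any `k` of its columns have rank `k`. -/
def TotallyFullRank (G : Matrix (Fin k) ι K) : Prop :=
  ∀ S : Finset ι, k ≤ S.card → ∀ v, (∀ i ∈ S, Matrix.vecMul v G i = 0) → v = 0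

lemma TotallyFullRank.eq_zero_of_mulVec_eq_zero {G : Matrix (Fin k) ι K}
    (hG : TotallyFullRank G) (hk : k ≤ Fintype.card ι) (S : Finset ι) (hS : S.card ≤ k)
    (y : ι → K) (hy : ∀ i ∉ S, y i = 0) (h : Matrix.mulVec G y = 0) : y = 0 := by
  classical
  obtain ⟨T, hST, hT⟩ := Finset.exists_superset_card_eq hS hk
  let e : Fin k ≃ T := (Fintype.equivFinOfCardEq (by simpa using hT)).symm
  let M : Matrix (Fin k) (Fin k) K := G.submatrix id fun a => (e a : ι)
  have hM : Function.Injective M.vecMul := by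
    rw [← Matrix.coe_vecMulLinear, injective_iff_map_eq_zero]
    intro v hv
    refine hG T hT.ge v fun i hi => ?_
    have := congrFun hv (e.symm ⟨i, hi⟩)
    simpa [M, Matrix.vecMul, dotProduct] using this
  have hM' := Matrix.mulVec_injective_iff_isUnit.2 (Matrix.vecMul_injective_iff_isUnit.1 hM)
  have hMy : M.mulVec (fun a => y (e a)) = 0 := by
    rw [← h]
    ext t
    have : ∑ i ∈ T, G t i * y i = ∑ i, G t i * y i :=
      Finset.sum_subset (Finset.subset_univ T) fun i _ hi => by
        rw [hy i fun h' => hi (hST h'), mul_zero]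
    simp only [Matrix.mulVec, dotProduct, M, Matrix.submatrix_apply, id]
    rw [← this, ← Finset.sum_coe_sort T, ← Equiv.sum_comp e]
  have hz : (fun a => y (e a)) = 0 := hM' (by rw [hMy, Matrix.mulVec_zero])
  ext i
  by_cases hi : i ∈ T
  · simpa using congrFun hz (e.symm ⟨i, hi⟩)
  · exact hy i fun h' => hi (hST h')

/-- If the rows of `D` have disjoint supports, then `G * D` has full rank if and only if `D` has
sufficiently many nonzero rows. -/
lemma TotallyFullRank.rank_mul_eq_iff {G : Matrix (Fin k) ι K} (hG : TotallyFullRank G)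
    (D : Matrix ι V K) (hD : ∀ i i' x, D i x ≠ 0 → D i' x ≠ 0 → i = i') :
    (G * D).rank = k ↔ k ≤ {i | ∃ x, D i x ≠ 0}.ncard := by
  classical
  set S := Finset.univ.filter fun i => ∃ x, D i x ≠ 0 with hSdef
  have key : ∀ v, Matrix.vecMul v (G * D) = 0 ↔ ∀ i ∈ S, Matrix.vecMul v G i = 0 := by
    intro v
    rw [← Matrix.vecMul_vecMul]
    constructor
    · intro h i hi
      obtain ⟨x, hx⟩ := (Finset.mem_filter.1 hi).2
      have h1 := congrFun h x
      rw [Matrix.vecMul, dotProduct, Finset.sum_eq_single i] at h1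
      · exact (mul_eq_zero.1 h1).resolve_right hx
      · intro i' _ hne
        have : D i' x = 0 := by
          by_contra h'
          exact hne (hD _ _ _ h' hx)
        rw [this, mul_zero]
      · simp
    · intro h
      ext x
      refine Finset.sum_eq_zero fun i _ => ?_
      by_cases hi : i ∈ S
      · rw [h i hi, zero_mul]
      · have : D i x = 0 := by
          by_contra h'
          exact hi (by simpa [hSdef] using ⟨x, h'⟩)
        exact mul_eq_zero_of_right _ this
  have hcard : {i | ∃ x, D i x ≠ 0}.ncard = S.card := by
    rw [← Set.ncard_coe_finset]
    simp [hSdef]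
  rw [rank_eq_iff_vecMul_eq_zero, hcard]
  constructor
  · intro h
    let f : (Fin k → K) →ₗ[K] (S → K) :=
      LinearMap.pi fun i => (LinearMap.proj (i : ι)).comp G.vecMulLinear
    have hf : Function.Injective f := by
      rw [injective_iff_map_eq_zero]
      intro v hv
      exact h v ((key v).2 fun i hi => congrFun hv ⟨i, hi⟩)
    simpa using LinearMap.finrank_le_finrank_of_injective hf
  · intro h v hv
    exact hG S h v ((key v).1 hv)

end Matrices

section Relations

variable {𝕂 : Type} [Field 𝕂] (r c m : ℕ) (hcr : c ≤ r) (nn : Fin (r + 1) → ℕ)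
  (l : ∀ i : Fin (r + 1), Fin (nn i) → ℕ) (A : Matrix (Fin (c + 1)) (Fin (r + 1)) 𝕂)

/-- The cofactors of the last row of the matrix defining `g_t`. -/
def lastCofactor (t : Fin (r - c)) (p : Fin (c + 2)) : 𝕂 :=
  (-1) ^ (c + 1 + (p : ℕ)) *
    ((A.submatrix id (colOf r c hcr t)).submatrix id p.succAbove).det

/-- The coefficient matrix of the `g_t` as linear forms in the monomials `T_i^{l_i}`. -/
def relMatrix : Matrix (Fin (r - c)) (Fin (r + 1)) 𝕂 :=
  Matrix.of fun t i => ∑ p, if colOf r c hcr t p = i then lastCofactor r c hcr A t p else 0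

lemma sum_relMatrix_mul {R : Type*} [CommRing R] (f : 𝕂 →+* R) (t : Fin (r - c))
    (y : Fin (r + 1) → R) :
    ∑ i, f (relMatrix r c hcr A t i) * y i =
      ∑ p, f (lastCofactor r c hcr A t p) * y (colOf r c hcr t p) := by
  simp only [relMatrix, Matrix.of_apply, map_sum, Finset.sum_mul]
  rw [Finset.sum_comm]
  refine Finset.sum_congr rfl fun p _ => ?_
  rw [Finset.sum_eq_single (colOf r c hcr t p)]
  · simp
  · intro i _ hi
    simp [hi.symm]
  · simp

lemma gPoly_eq_sum (t : Fin (r - c)) :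
    gPoly 𝕂 r c m hcr nn l A t = ∑ i, C (relMatrix r c hcr A t i) * Tmon 𝕂 r m nn l i := by
  rw [sum_relMatrix_mul, gPoly]
  refine (det_of_last_row
    (Matrix.of fun q p => C (A q (colOf r c hcr t p))) fun p => _).trans ?_
  refine Finset.sum_congr rfl fun p _ => ?_
  rw [lastCofactor, map_mul, RingHom.map_det]
  simp
  left
  rfl

lemma sum_relMatrix_mul_row (t : Fin (r - c)) (q : Fin (c + 1)) :
    ∑ i, relMatrix r c hcr A t i * A q i = 0 := by
  have h := sum_relMatrix_mul r c hcr A (RingHom.id 𝕂) t (A q)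
  simp only [RingHom.id_apply] at h
  rw [h]
  refine (det_of_last_row (A.submatrix id (colOf r c hcr t))
    fun p => A q (colOf r c hcr t p)).symm.trans ?_
  refine Matrix.det_zero_of_row_eq (i := q.castSucc) (j := Fin.last (c + 1))
    (Fin.castSucc_lt_last q).ne ?_
  ext p
  simp

lemma totallyFullRank_relMatrix
    (hA : ∀ s : Finset (Fin (r + 1)), s.card = c + 1 →
      LinearIndependent 𝕂 fun j : s => A.transpose (j : Fin (r + 1))) :
    TotallyFullRank (relMatrix r c hcr A) := by
  intro S hS v hv
  have hker : ∀ q, ∑ i, Matrix.vecMul v (relMatrix r c hcr A) i * A q i = 0 := by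
    intro q
    simp only [Matrix.vecMul, dotProduct, Finset.sum_mul]
    rw [Finset.sum_comm]
    refine Finset.sum_eq_zero fun t _ => ?_
    simp only [mul_assoc]
    rw [← Finset.mul_sum, sum_relMatrix_mul_row, mul_zero]
  obtain ⟨T, hT, hTc⟩ := Finset.exists_superset_card_eq (s := Sᶜ) (n := c + 1)
    (by rw [Finset.card_compl, Fintype.card_fin]; omega) (by simpa using hcr)
  have hw : ∀ i, Matrix.vecMul v (relMatrix r c hcr A) i = 0 := by
    have hout : ∀ i ∉ T, Matrix.vecMul v (relMatrix r c hcr A) i = 0 := fun i hi =>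
      hv i (by by_contra h; exact hi (hT (by simpa using h)))
    have hli := Fintype.linearIndependent_iff.1 (hA T hTc)
      (fun i => Matrix.vecMul v (relMatrix r c hcr A) i) (by
        ext q
        simp only [Finset.sum_apply, Pi.smul_apply, smul_eq_mul, Matrix.transpose_apply,
          Pi.zero_apply]
        rw [← hker q, Finset.sum_coe_sort T
          (fun i => Matrix.vecMul v (relMatrix r c hcr A) i * A q i)]
        exact Finset.sum_subset (Finset.subset_univ T) fun i _ hi => by
          rw [hout i hi, zero_mul])
    intro i
    by_cases hi : i ∈ T
    · exact hli ⟨i, hi⟩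
    · exact hout i hi
  have hdet : (A.submatrix id (Fin.castLE (by omega : c + 1 ≤ r + 1))).det ≠ 0 := by
    have hinj : Function.Injective (Fin.castLE (by omega : c + 1 ≤ r + 1)) :=
      Fin.castLE_injective _
    have hli := hA (Finset.univ.map ⟨_, hinj⟩) (by simp)
    have hli' := hli.comp (fun a : Fin (c + 1) => ⟨Fin.castLE (by omega) a, by simp⟩)
      (fun a b h => hinj (by simpa using h))
    have hu := Matrix.linearIndependent_cols_iff_isUnit (A := A.submatrix id
      (Fin.castLE (by omega : c + 1 ≤ r + 1))) |>.1 hli'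
    exact ((Matrix.isUnit_iff_isUnit_det _).1 hu).ne_zero
  ext t
  have hlt := t.isLt
  have h := hw ⟨c + 1 + t, by omega⟩
  have hcoef : ∀ t', relMatrix r c hcr A t' ⟨c + 1 + t, by omega⟩ =
      if t' = t then (A.submatrix id (Fin.castLE (by omega : c + 1 ≤ r + 1))).det else 0 := by
    intro t'
    rw [relMatrix, Matrix.of_apply, Finset.sum_eq_single (Fin.last (c + 1))]
    · have hcol : colOf r c hcr t' (Fin.last (c + 1)) = ⟨c + 1 + t, by omega⟩ ↔ t' = t := by
        simp [colOf, Fin.ext_iff]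
      simp only [hcol]
      refine if_congr Iff.rfl ?_ rfl
      have hsub : (A.submatrix id (colOf r c hcr t')).submatrix id
          (Fin.last (c + 1)).succAbove =
            A.submatrix id (Fin.castLE (by omega : c + 1 ≤ r + 1)) := by
        ext a b
        have hb : (b : ℕ) ≤ c := by omega
        simp only [Matrix.submatrix_apply, id, Fin.succAbove_last]
        congr 1
        simp [colOf, Fin.ext_iff, hb]
      rw [lastCofactor, hsub, Fin.val_last, ← two_mul, pow_mul]
      simp
    · intro p _ hp
      have hpc : (p : ℕ) ≤ c := by
        have := Fin.val_lt_last hp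
        omega
      refine if_neg ?_
      simp only [colOf, hpc, dite_true, Fin.ext_iff]
      omega
    · simp
  rw [Matrix.vecMul, dotProduct] at h
  simp only [hcoef, mul_ite, mul_zero, Finset.sum_ite_eq', Finset.mem_univ, if_true] at h
  exact (mul_eq_zero.1 h).resolve_right hdet

lemma eval_gPoly (z : VarIdx r m nn → 𝕂) (t : Fin (r - c)) :
    eval z (gPoly 𝕂 r c m hcr nn l A t) =
      Matrix.mulVec (relMatrix r c hcr A) (fun i => ∏ j, z (Sum.inl ⟨i, j⟩) ^ l i j) t := by
  simp [gPoly_eq_sum, Matrix.mulVec, dotProduct, Tmon]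

lemma Jac_eq_mul (z : VarIdx r m nn → 𝕂) :
    Jac 𝕂 r c m hcr nn l A z = relMatrix r c hcr A *
      Matrix.of fun i x => eval z (pderiv x (Tmon 𝕂 r m nn l i)) := by
  ext t x
  simp only [Jac, Matrix.of_apply, Matrix.mul_apply, gPoly_eq_sum, map_sum, pderiv_C_mul,
    map_mul, eval_C]

end Relations

section Monomials

variable {𝕂 : Type} [Field 𝕂] {r m : ℕ} {nn : Fin (r + 1) → ℕ}
  {l : ∀ i : Fin (r + 1), Fin (nn i) → ℕ}

lemma pderiv_prod_X_pow_eq_zero {R σ ι : Type*} [CommRing R] (x : σ) (s : Finset ι) (f : ι → σ)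
    (e : ι → ℕ) (h : ∀ j ∈ s, f j ≠ x) :
    pderiv x (∏ j ∈ s, (X (f j) : MvPolynomial σ R) ^ e j) = 0 := by
  classical
  induction s using Finset.induction_on with
  | empty => simp
  | insert a s ha ih =>
    rw [Finset.prod_insert ha, pderiv_mul, pderiv_pow,
      pderiv_X_of_ne (h a (Finset.mem_insert_self a s)),
      ih fun j hj => h j (Finset.mem_insert_of_mem hj)]
    simp

/-- The block derivative `∂T_i^{l_i}/∂T_{ij}` at a point. -/
lemma eval_pderiv_Tmon (z : VarIdx r m nn → 𝕂) (i : Fin (r + 1)) (j : Fin (nn i)) :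
    eval z (pderiv (Sum.inl ⟨i, j⟩) (Tmon 𝕂 r m nn l i)) =
      l i j * z (Sum.inl ⟨i, j⟩) ^ (l i j - 1) *
        ∏ j' ∈ Finset.univ.erase j, z (Sum.inl ⟨i, j'⟩) ^ l i j' := by
  rw [Tmon, ← Finset.mul_prod_erase _ _ (Finset.mem_univ j), pderiv_mul, pderiv_pow,
    pderiv_X_self, pderiv_prod_X_pow_eq_zero (Sum.inl ⟨i, j⟩) (Finset.univ.erase j)
      (fun j' => (Sum.inl ⟨i, j'⟩ : VarIdx r m nn)) (l i) (by simp)]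
  simp

lemma exists_of_eval_pderiv_Tmon_ne_zero {z : VarIdx r m nn → 𝕂} {i : Fin (r + 1)}
    {x : VarIdx r m nn} (h : eval z (pderiv x (Tmon 𝕂 r m nn l i)) ≠ 0) :
    ∃ j, x = Sum.inl ⟨i, j⟩ := by
  by_contra! hx
  refine h ?_
  rw [Tmon, pderiv_prod_X_pow_eq_zero x Finset.univ
    (fun j' => (Sum.inl ⟨i, j'⟩ : VarIdx r m nn)) (l i) fun j _ hj => hx j hj.symm, map_zero]

/-- At a point vanishing on a block of total degree at least two, the block derivatives vanish. -/
lemma eval_pderiv_Tmon_eq_zero {z : VarIdx r m nn → 𝕂}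
    {i : Fin (r + 1)} (hi : 2 ≤ ∑ j, l i j) (hz : ∀ j, z (Sum.inl ⟨i, j⟩) = 0)
    (x : VarIdx r m nn) : eval z (pderiv x (Tmon 𝕂 r m nn l i)) = 0 := by
  by_contra h
  obtain ⟨j, rfl⟩ := exists_of_eval_pderiv_Tmon_ne_zero h
  rw [eval_pderiv_Tmon] at h
  have h1 := right_ne_zero_of_mul h
  have h2 := right_ne_zero_of_mul (left_ne_zero_of_mul h)
  rw [hz j] at h2
  have hlj : l i j - 1 = 0 := by
    by_contra h'
    exact h2 (zero_pow h')
  have he : ∀ j' ∈ Finset.univ.erase j, l i j' = 0 := by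
    intro j' hj'
    have := Finset.prod_ne_zero_iff.1 h1 j' hj'
    rw [hz j'] at this
    by_contra h'
    exact this (zero_pow h')
  rw [← Finset.add_sum_erase _ _ (Finset.mem_univ j), Finset.sum_eq_zero he] at hi
  omega

/-- At a point with exactly one nonzero coordinate in a block, some block derivative is nonzero if
and only if the block has one further variable, and this variable occurs linearly. -/
lemma exists_eval_pderiv_Tmon_ne_zero_iff [CharZero 𝕂] (hl : ∀ i j, 0 < l i j)
    {z : VarIdx r m nn → 𝕂} {i : Fin (r + 1)} (hi : 2 ≤ nn i) (j₀ : Fin (nn i))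
    (hz : ∀ j, z (Sum.inl ⟨i, j⟩) ≠ 0 ↔ j = j₀) :
    (∃ x, eval z (pderiv x (Tmon 𝕂 r m nn l i)) ≠ 0) ↔
      nn i = 2 ∧ ∀ j, j ≠ j₀ → l i j = 1 := by
  constructor
  · rintro ⟨x, h⟩
    obtain ⟨j, rfl⟩ := exists_of_eval_pderiv_Tmon_ne_zero h
    rw [eval_pderiv_Tmon] at h
    have h1 := right_ne_zero_of_mul h
    have h2 := right_ne_zero_of_mul (left_ne_zero_of_mul h)
    have he : ∀ j', j' ≠ j → j' = j₀ := by
      intro j' hj'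
      rw [← hz j']
      intro h'
      refine Finset.prod_ne_zero_iff.1 h1 j' (by simpa using hj') ?_
      rw [h', zero_pow (hl i j').ne']
    have hcard : (Finset.univ.erase j).card ≤ 1 :=
      Finset.card_le_one.2 fun a ha b hb => by
        rw [he a (Finset.ne_of_mem_erase ha), he b (Finset.ne_of_mem_erase hb)]
    rw [Finset.card_erase_of_mem (Finset.mem_univ j), Finset.card_univ, Fintype.card_fin]
      at hcard
    refine ⟨by omega, fun j' hj' => ?_⟩
    have hjj : j' = j := by
      by_contra h'
      exact hj' (he j' h')
    subst hjj
    have hz0 : z (Sum.inl ⟨i, j'⟩) = 0 := by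
      by_contra h'
      exact hj' ((hz j').1 h')
    rw [hz0] at h2
    have := hl i j'
    by_contra h'
    exact h2 (zero_pow (by omega))
  · rintro ⟨h2, h1⟩
    have : Nontrivial (Fin (nn i)) := Fin.nontrivial_iff_two_le.2 hi
    obtain ⟨j, hj⟩ := exists_ne j₀
    refine ⟨Sum.inl ⟨i, j⟩, ?_⟩
    rw [eval_pderiv_Tmon, h1 j hj]
    simp only [Nat.cast_one, Nat.sub_self, pow_zero, mul_one, one_mul]
    refine Finset.prod_ne_zero_iff.2 fun j' hj' => pow_ne_zero _ ((hz j').2 ?_)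
    have hne := Finset.ne_of_mem_erase hj'
    have e1 := Fin.val_ne_of_ne hne
    have e2 := Fin.val_ne_of_ne hj
    ext
    omega

/-- The value of a monomial at a point with at most one nonzero coordinate in its block. -/
lemma prod_pow_ne_zero_iff (hl : ∀ i j, 0 < l i j) {z : VarIdx r m nn → 𝕂} {i : Fin (r + 1)}
    (j₀ : Fin (nn i)) (hz : ∀ j, z (Sum.inl ⟨i, j⟩) ≠ 0 ↔ j = j₀) :
    ∏ j, z (Sum.inl ⟨i, j⟩) ^ l i j ≠ 0 ↔ nn i = 1 := by
  simp only [Finset.prod_ne_zero_iff, Finset.mem_univ, true_imp_iff,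
    pow_ne_zero_iff (hl i _).ne', hz]
  constructor
  · intro h
    have : Subsingleton (Fin (nn i)) := ⟨fun a b => (h a).trans (h b).symm⟩
    have := Fin.subsingleton_iff_le_one.1 this
    have := j₀.pos
    omega
  · intro h j
    have := Fin.subsingleton_iff_le_one.2 h.le
    exact Subsingleton.elim _ _

lemma prod_pow_eq_zero (hnn : ∀ i, 0 < nn i) (hl : ∀ i j, 0 < l i j) {z : VarIdx r m nn → 𝕂}
    {i : Fin (r + 1)} (hz : ∀ j, z (Sum.inl ⟨i, j⟩) = 0) :
    ∏ j, z (Sum.inl ⟨i, j⟩) ^ l i j = 0 :=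
  Finset.prod_eq_zero (Finset.mem_univ ⟨0, hnn i⟩) (by rw [hz, zero_pow (hl i _).ne'])

end Monomials

section TwoCoordinates

variable {𝕂 : Type} [Field 𝕂] {r m : ℕ} {nn : Fin (r + 1) → ℕ} {i₁ i₂ : Fin (r + 1)}
  {j₁ : Fin (nn i₁)} {j₂ : Fin (nn i₂)}

/-- The nonzero coordinates of `z` are exactly `z_{i₁j₁}` and `z_{i₂j₂}`. -/
def SupportedOnPair (j₁ : Fin (nn i₁)) (j₂ : Fin (nn i₂)) (z : VarIdx r m nn → 𝕂) : Prop :=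
  ∀ v, z v ≠ 0 ↔ (v = Sum.inl ⟨i₁, j₁⟩ ∨ v = Sum.inl ⟨i₂, j₂⟩)

lemma SupportedOnPair.symm {z : VarIdx r m nn → 𝕂} (hz : SupportedOnPair j₁ j₂ z) :
    SupportedOnPair j₂ j₁ z := fun v => (hz v).trans or_comm

lemma SupportedOnPair.ne_zero_iff (hi : i₁ ≠ i₂) {z : VarIdx r m nn → 𝕂}
    (hz : SupportedOnPair j₁ j₂ z) (j : Fin (nn i₁)) :
    z (Sum.inl ⟨i₁, j⟩) ≠ 0 ↔ j = j₁ := by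
  rw [hz]
  simp [hi]

lemma SupportedOnPair.eq_zero {z : VarIdx r m nn → 𝕂} (hz : SupportedOnPair j₁ j₂ z)
    {i : Fin (r + 1)} (h₁ : i ≠ i₁) (h₂ : i ≠ i₂) (j : Fin (nn i)) :
    z (Sum.inl ⟨i, j⟩) = 0 := by
  by_contra h
  have := (hz _).1 h
  simp [h₁, h₂] at this

lemma exists_supportedOnPair (hi : i₁ ≠ i₂) {w₁ w₂ : 𝕂} (h₁ : w₁ ≠ 0) (h₂ : w₂ ≠ 0) :
    ∃ z : VarIdx r m nn → 𝕂, SupportedOnPair j₁ j₂ z ∧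
      z (Sum.inl ⟨i₁, j₁⟩) = w₁ ∧ z (Sum.inl ⟨i₂, j₂⟩) = w₂ := by
  classical
  refine ⟨fun v => if v = Sum.inl ⟨i₁, j₁⟩ then w₁ else
    if v = Sum.inl ⟨i₂, j₂⟩ then w₂ else 0, fun v => ?_, by simp, by simp [hi.symm]⟩
  dsimp only
  split_ifs <;> simp [*]

variable {l : ∀ i : Fin (r + 1), Fin (nn i) → ℕ}

lemma SupportedOnPair.prod_pow_eq_zero (hi : i₁ ≠ i₂) (hnn : ∀ i, 0 < nn i)
    (hl : ∀ i j, 0 < l i j) (h₁ : 2 ≤ nn i₁) (h₂ : 2 ≤ nn i₂) {z : VarIdx r m nn → 𝕂}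
    (hz : SupportedOnPair j₁ j₂ z) (i : Fin (r + 1)) :
    ∏ j, z (Sum.inl ⟨i, j⟩) ^ l i j = 0 := by
  by_cases e₁ : i = i₁
  · subst e₁
    by_contra h
    have := (prod_pow_ne_zero_iff hl j₁ (hz.ne_zero_iff hi)).1 h
    omega
  by_cases e₂ : i = i₂
  · subst e₂
    by_contra h
    have := (prod_pow_ne_zero_iff hl j₂ (hz.symm.ne_zero_iff hi.symm)).1 h
    omega
  exact _root_.prod_pow_eq_zero hnn hl (hz.eq_zero e₁ e₂)

open Classical in
/-- The number of nonvanishing gradients of the monomials `T_i^{l_i}` at a point with two nonzero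
coordinates. -/
lemma SupportedOnPair.ncard_eq [CharZero 𝕂] (hi : i₁ ≠ i₂) (hl : ∀ i j, 0 < l i j)
    (hirr : ∀ i, 2 ≤ ∑ j, l i j) (h₁ : 2 ≤ nn i₁) (h₂ : 2 ≤ nn i₂) {z : VarIdx r m nn → 𝕂}
    (hz : SupportedOnPair j₁ j₂ z) :
    {i | ∃ x, eval z (pderiv x (Tmon 𝕂 r m nn l i)) ≠ 0}.ncard =
      (if nn i₁ = 2 ∧ ∀ j, j ≠ j₁ → l i₁ j = 1 then 1 else 0) +
        (if nn i₂ = 2 ∧ ∀ j, j ≠ j₂ → l i₂ j = 1 then 1 else 0) := by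
  have e : {i | ∃ x, eval z (pderiv x (Tmon 𝕂 r m nn l i)) ≠ 0} =
      ↑(({i₁, i₂} : Finset (Fin (r + 1))).filter
        fun i => ∃ x, eval z (pderiv x (Tmon 𝕂 r m nn l i)) ≠ 0) := by
    ext i
    simp only [Finset.coe_filter, Set.mem_ofPred_eq, Finset.mem_insert,
      Finset.mem_singleton, iff_and_self]
    rintro ⟨x, hx⟩
    by_contra! h
    exact hx (eval_pderiv_Tmon_eq_zero (hirr i) (hz.eq_zero h.1 h.2) x)
  rw [e, Set.ncard_coe_finset, Finset.filter_insert, Finset.filter_singleton]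
  simp only [exists_eval_pderiv_Tmon_ne_zero_iff hl h₁ j₁ (hz.ne_zero_iff hi),
    exists_eval_pderiv_Tmon_ne_zero_iff hl h₂ j₂ (hz.symm.ne_zero_iff hi.symm)]
  split_ifs <;> simp [hi]

end TwoCoordinates

/-- Assume `r > c` and fix distinct `i₁ ≠ i₂` and `j₁`, `j₂`.
(a) There is a point of `X̄` whose nonzero coordinates are exactly
`z_{i₁j₁}, z_{i₂j₂}` iff either `n_{i₁}, n_{i₂} ≥ 2`, or `n_{i₁} = n_{i₂} = 1` and
`r = c+1`.  (b) If moreover the data is irredundant and `n_{i₁}, n_{i₂} ≥ 2`, then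
every such point of `X̄` has full-rank Jacobian iff either `r = c+1` and for some
`t ∈ {1,2}` one has `n_{i_t} = 2` and `l_{i_t j'} = 1` for the index `j' ≠ j_t`, or
`r = c+2`, `n_{i₁} = n_{i₂} = 2` and `l_{i₁j'} = l_{i₂j''} = 1` for the indices
`j' ≠ j₁`, `j'' ≠ j₂`. -/
theorem statement_19
    (𝕂 : Type) [Field 𝕂] [IsAlgClosed 𝕂] [CharZero 𝕂]
    (r c m : ℕ) (hc : 0 < c) (hcr : c ≤ r)
    (nn : Fin (r + 1) → ℕ) (hnn : ∀ i, 0 < nn i)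
    (l : ∀ i : Fin (r + 1), Fin (nn i) → ℕ) (hl : ∀ i j, 0 < l i j)
    (A : Matrix (Fin (c + 1)) (Fin (r + 1)) 𝕂)
    (hA : ∀ s : Finset (Fin (r + 1)), s.card = c + 1 →
      LinearIndependent 𝕂 fun j : s => A.transpose (j : Fin (r + 1)))
    (hrc : c < r) (i₁ i₂ : Fin (r + 1)) (hi : i₁ ≠ i₂)
    (j₁ : Fin (nn i₁)) (j₂ : Fin (nn i₂)) :
    ((∃ z : VarIdx r m nn → 𝕂,
        (∀ t : Fin (r - c), MvPolynomial.eval z (gPoly 𝕂 r c m hcr nn l A t) = 0) ∧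
        (∀ v : VarIdx r m nn, z v ≠ 0 ↔ (v = Sum.inl ⟨i₁, j₁⟩ ∨ v = Sum.inl ⟨i₂, j₂⟩))) ↔
      ((2 ≤ nn i₁ ∧ 2 ≤ nn i₂) ∨ (nn i₁ = 1 ∧ nn i₂ = 1 ∧ r = c + 1))) ∧
    ((∀ i' : Fin (r + 1), 2 ≤ ∑ j' : Fin (nn i'), l i' j') →
      2 ≤ nn i₁ → 2 ≤ nn i₂ →
      ((∀ z : VarIdx r m nn → 𝕂,
          (∀ t : Fin (r - c), MvPolynomial.eval z (gPoly 𝕂 r c m hcr nn l A t) = 0) →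
          (∀ v : VarIdx r m nn, z v ≠ 0 ↔ (v = Sum.inl ⟨i₁, j₁⟩ ∨ v = Sum.inl ⟨i₂, j₂⟩)) →
          (Jac 𝕂 r c m hcr nn l A z).rank = r - c) ↔
        ((r = c + 1 ∧
            ((nn i₁ = 2 ∧ ∀ j' : Fin (nn i₁), j' ≠ j₁ → l i₁ j' = 1) ∨
             (nn i₂ = 2 ∧ ∀ j' : Fin (nn i₂), j' ≠ j₂ → l i₂ j' = 1))) ∨
         (r = c + 2 ∧ nn i₁ = 2 ∧ nn i₂ = 2 ∧
            (∀ j' : Fin (nn i₁), j' ≠ j₁ → l i₁ j' = 1) ∧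
            (∀ j'' : Fin (nn i₂), j'' ≠ j₂ → l i₂ j'' = 1))))) := by
  have hG := totallyFullRank_relMatrix r c hcr A hA
  have hk : r - c ≤ Fintype.card (Fin (r + 1)) := by
    rw [Fintype.card_fin]
    omega
  change ((∃ z : VarIdx r m nn → 𝕂, _ ∧ SupportedOnPair j₁ j₂ z) ↔ _) ∧
    (_ → _ → _ → ((∀ z : VarIdx r m nn → 𝕂, _ → SupportedOnPair j₁ j₂ z → _) ↔ _))
  simp only [eval_gPoly]
  constructor
  · constructor
    · rintro ⟨z, hg, hz⟩
      set y : Fin (r + 1) → 𝕂 := fun i => ∏ j, z (Sum.inl ⟨i, j⟩) ^ l i j with hy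
      have y_one : y i₁ ≠ 0 ↔ nn i₁ = 1 := prod_pow_ne_zero_iff hl j₁ (hz.ne_zero_iff hi)
      have y_two : y i₂ ≠ 0 ↔ nn i₂ = 1 :=
        prod_pow_ne_zero_iff hl j₂ (hz.symm.ne_zero_iff hi.symm)
      have y_out : ∀ i, i ≠ i₁ → i ≠ i₂ → y i = 0 := fun i h₁ h₂ =>
        prod_pow_eq_zero hnn hl (hz.eq_zero h₁ h₂)
      have hzero := fun S hS h => hG.eq_zero_of_mulVec_eq_zero hk S hS y h (funext hg)
      have n_one := hnn i₁
      have n_two := hnn i₂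
      by_cases h₁ : nn i₁ = 1 <;> by_cases h₂ : nn i₂ = 1
      · refine Or.inr ⟨h₁, h₂, ?_⟩
        by_contra hr
        refine y_one.2 h₁ (congrFun (hzero {i₁, i₂} ?_ fun i h => ?_) i₁)
        · rw [Finset.card_pair hi]
          omega
        · simp only [Finset.mem_insert, Finset.mem_singleton, not_or] at h
          exact y_out i h.1 h.2
      · refine absurd (congrFun (hzero {i₁} ?_ fun i h => ?_) i₁) (y_one.2 h₁)
        · rw [Finset.card_singleton]
          omega
        · by_cases e : i = i₂
          · rw [e]
            exact not_not.1 (mt y_two.1 h₂)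
          · exact y_out i (by simpa using h) e
      · refine absurd (congrFun (hzero {i₂} ?_ fun i h => ?_) i₂) (y_two.2 h₂)
        · rw [Finset.card_singleton]
          omega
        · by_cases e : i = i₁
          · rw [e]
            exact not_not.1 (mt y_one.1 h₁)
          · exact y_out i e (by simpa using h)
      · left
        omega
    · rintro (⟨h₁, h₂⟩ | ⟨h₁, h₂, hr⟩)
      · obtain ⟨z, hz, -⟩ := exists_supportedOnPair (m := m) (j₁ := j₁) (j₂ := j₂) hi
          (one_ne_zero (α := 𝕂)) (one_ne_zero (α := 𝕂))
        refine ⟨z, fun t => ?_, hz⟩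
        simp [Matrix.mulVec, dotProduct, hz.prod_pow_eq_zero hi hnn hl h₁ h₂]
      · have : Subsingleton (Fin (r - c)) := Fin.subsingleton_iff_le_one.2 (by omega)
        have hne : ∀ t i, relMatrix r c hcr A t i ≠ 0 := by
          intro t i h
          refine one_ne_zero (congrFun (hG {i} (by simp; omega) (fun _ => 1) ?_) t)
          simp [Matrix.vecMul, dotProduct, Fintype.sum_subsingleton _ t, h]
        let t₀ : Fin (r - c) := ⟨0, by omega⟩
        obtain ⟨w₁, hw₁⟩ := IsAlgClosed.exists_pow_nat_eq
          (relMatrix r c hcr A t₀ i₂) (hl i₁ j₁)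
        obtain ⟨w₂, hw₂⟩ := IsAlgClosed.exists_pow_nat_eq
          (-relMatrix r c hcr A t₀ i₁) (hl i₂ j₂)
        have w₁_ne_zero : w₁ ≠ 0 := by
          rintro rfl
          rw [zero_pow (hl i₁ j₁).ne'] at hw₁
          exact hne _ _ hw₁.symm
        have w₂_ne_zero : w₂ ≠ 0 := by
          rintro rfl
          rw [zero_pow (hl i₂ j₂).ne'] at hw₂
          exact hne _ _ (neg_eq_zero.1 hw₂.symm)
        obtain ⟨z, hz, hz₁, hz₂⟩ := exists_supportedOnPair (m := m) (j₁ := j₁) (j₂ := j₂) hi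
          w₁_ne_zero w₂_ne_zero
        refine ⟨z, fun t => ?_, hz⟩
        have : Subsingleton (Fin (nn i₁)) := Fin.subsingleton_iff_le_one.2 h₁.le
        have : Subsingleton (Fin (nn i₂)) := Fin.subsingleton_iff_le_one.2 h₂.le
        rw [Subsingleton.elim t t₀, Matrix.mulVec, dotProduct, Fintype.sum_eq_add i₁ i₂ hi
          fun i h => by rw [prod_pow_eq_zero hnn hl (hz.eq_zero h.1 h.2), mul_zero],
          Fintype.prod_subsingleton _ j₁, Fintype.prod_subsingleton _ j₂, hz₁, hz₂, hw₁, hw₂]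
        ring
  · intro hirr h₁ h₂
    classical
    have hrank : ∀ z : VarIdx r m nn → 𝕂, SupportedOnPair j₁ j₂ z →
        ((Jac 𝕂 r c m hcr nn l A z).rank = r - c ↔ r - c ≤
          (if nn i₁ = 2 ∧ ∀ j, j ≠ j₁ → l i₁ j = 1 then 1 else 0) +
            (if nn i₂ = 2 ∧ ∀ j, j ≠ j₂ → l i₂ j = 1 then 1 else 0)) := by
      intro z hz
      rw [Jac_eq_mul, hG.rank_mul_eq_iff, ← hz.ncard_eq hi hl hirr h₁ h₂]
      · rfl
      · intro i i' x hx hx'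
        obtain ⟨j, rfl⟩ := exists_of_eval_pderiv_Tmon_ne_zero hx
        obtain ⟨j', h⟩ := exists_of_eval_pderiv_Tmon_ne_zero hx'
        simp only [Sum.inl.injEq, Sigma.mk.injEq] at h
        exact h.1
    obtain ⟨z₀, hz₀, -⟩ := exists_supportedOnPair (m := m) (j₁ := j₁) (j₂ := j₂) hi
      (one_ne_zero (α := 𝕂)) (one_ne_zero (α := 𝕂))
    have hall : (∀ z : VarIdx r m nn → 𝕂,
        (∀ t, Matrix.mulVec (relMatrix r c hcr A)
          (fun i => ∏ j, z (Sum.inl ⟨i, j⟩) ^ l i j) t = 0) → SupportedOnPair j₁ j₂ z →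
        (Jac 𝕂 r c m hcr nn l A z).rank = r - c) ↔
          (Jac 𝕂 r c m hcr nn l A z₀).rank = r - c := by
      constructor
      · intro h
        refine h z₀ (fun t => ?_) hz₀
        simp [Matrix.mulVec, dotProduct, hz₀.prod_pow_eq_zero hi hnn hl h₁ h₂]
      · intro h z _ hz
        rwa [hrank z hz, ← hrank z₀ hz₀]
    rw [hall, hrank z₀ hz₀]
    split_ifs with g₁ g₂ g₂
    · constructor
      · intro h
        by_cases hr : r = c + 1
        · exact Or.inl ⟨hr, Or.inl g₁⟩
        · exact Or.inr ⟨by omega, g₁.1, g₂.1, g₁.2, g₂.2⟩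
      · omega
    · constructor
      · exact fun h => Or.inl ⟨by omega, Or.inl g₁⟩
      · rintro (⟨hr, -⟩ | ⟨-, -, h, -, h'⟩)
        · omega
        · exact absurd ⟨h, h'⟩ g₂
    · constructor
      · exact fun h => Or.inl ⟨by omega, Or.inr g₂⟩
      · rintro (⟨hr, -⟩ | ⟨-, h, -, h', -⟩)
        · omega
        · exact absurd ⟨h, h'⟩ g₁
    · constructor
      · intro h
        omega
      · rintro (⟨-, h | h⟩ | ⟨-, h, -, h', -⟩)
        · exact absurd h g₁
        · exact absurd h g₂
        · exact absurd ⟨h, h'⟩ g₁
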